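/- For any number of servers n ≥ 2, any number of machine schedulers m ≥ 1, any attack strength α ≥ 0, and any machine masses r_1,…,r_m ≥ 0 with Σ_k r_k ≤ n, a team equilibrium exists: there exist vectors x^s, x^1, …, x^m in ℝ^n with x^s ≥ 0 componentwise, Σ_i x^s_i = n − Σ_k r_k, each x^k ≥ 0 componentwise with Σ_i x^k_i = r_k, such that (i) for every machine k and every y ≥ 0 with Σ_i y_i = r_k, C^α(x^s + y + Σ_{j≠k} x^j) ≥ C^α(x^s + Σ_j x^j), and (ii) writing x = x^s + Σ_k x^k, x^s_i > 0 implies τ_i^α(x_i) ≤ τ_j^α(x_j) for all j. -/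

import Mathlib

open Finset

/-- System cost `C^α(x) = (1/n) ∑ᵢ xᵢ τᵢ(xᵢ) + α x₁ / n` (server 1 is index 0). -/
noncomputable def cost (n : ℕ) [NeZero n] (τ : Fin n → ℝ → ℝ) (α : ℝ) (x : Fin n → ℝ) : ℝ :=
  (∑ i, x i * τ i (x i)) / (n : ℝ) + α * x 0 / (n : ℝ)

/-- Attacked delay functions: `τ₁^α = τ₁ + α`, `τᵢ^α = τᵢ` for `i > 1`. -/
noncomputable def tauA (n : ℕ) [NeZero n] (τ : Fin n → ℝ → ℝ) (α : ℝ) (i : Fin n) (z : ℝ) : ℝ :=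
  τ i z + if i = 0 then α else 0

/-- A (partial) scheduling profile of total mass `mass`: nonnegative with entries summing to `mass`. -/
def IsProfile (n : ℕ) (mass : ℝ) (x : Fin n → ℝ) : Prop :=
  (∀ i, 0 ≤ x i) ∧ ∑ i, x i = mass

/-- Team equilibrium: the selfish mass `n - ∑ r k` is scheduled by `xs`, machine `k`
schedules mass `r k` via `xk k`; every machine schedules globally optimally given the
others, and every selfish job is on a minimum-delay server. -/
def IsTeamEq (n m : ℕ) [NeZero n] (τ : Fin n → ℝ → ℝ) (α : ℝ) (r : Fin m → ℝ)
    (xs : Fin n → ℝ) (xk : Fin m → Fin n → ℝ) : Prop :=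
  IsProfile n ((n : ℝ) - ∑ k, r k) xs ∧
  (∀ k, IsProfile n (r k) (xk k)) ∧
  (∀ k, ∀ y : Fin n → ℝ, IsProfile n (r k) y →
    cost n τ α (xs + ∑ j, xk j) ≤ cost n τ α (xs + y + ∑ j ∈ univ.erase k, xk j)) ∧
  (∀ i, 0 < xs i → ∀ j,
    tauA n τ α i ((xs + ∑ l, xk l) i) ≤ tauA n τ α j ((xs + ∑ l, xk l) j))

/-- Continuous separable costs have a Wardrop equilibrium of any mass. -/
theorem exists_wardrop {ι : Type*} [Fintype ι] [Nonempty ι] (h : ι → ℝ → ℝ)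
    (hc : ∀ i, Continuous (h i)) {N : ℝ} (hN : 0 ≤ N) :
    ∃ x : ι → ℝ, (∀ i, 0 ≤ x i) ∧ ∑ i, x i = N ∧
      ∀ i, 0 < x i → ∀ j, h i (x i) ≤ h j (x j) := by
  classical
  set K : Set (ι → ℝ) := {x | (∀ i, 0 ≤ x i) ∧ ∑ i, x i = N} with hK
  have hKc : IsCompact K := by
    refine (isCompact_Icc (a := (0 : ι → ℝ)) (b := fun _ => N)).of_isClosed_subset ?_ ?_
    · simp only [hK, Set.ofPred_and, Set.ofPred_forall]
      exact (isClosed_iInter fun i => isClosed_le continuous_const (continuous_apply i)).inter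
        (isClosed_eq (by fun_prop) continuous_const)
    · rintro x ⟨hx, hs⟩
      exact ⟨hx, fun i => hs ▸ single_le_sum (fun j _ => hx j) (mem_univ i)⟩
  have hKn : K.Nonempty := by
    obtain ⟨i⟩ := ‹Nonempty ι›
    refine ⟨Pi.single i N, fun j => ?_, by simp⟩
    by_cases hj : j = i
    · subst hj; simpa using hN
    · simp [hj]
  have hH : ∀ i t, HasDerivAt (fun u => ∫ s in (0 : ℝ)..u, h i s) (h i t) t := fun i t =>
    intervalIntegral.integral_hasDerivAt_right ((hc i).intervalIntegrable _ _)
      ((hc i).stronglyMeasurableAtFilter _ _) (hc i).continuousAt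
  have hHc : ∀ i, Continuous (fun u => ∫ s in (0 : ℝ)..u, h i s) := fun i =>
    continuous_iff_continuousAt.2 fun t => (hH i t).continuousAt
  obtain ⟨x, ⟨hx, hs⟩, hmin⟩ := hKc.exists_isMinOn hKn
    (f := fun x : ι → ℝ => ∑ i, ∫ s in (0 : ℝ)..x i, h i s)
    (Continuous.continuousOn (continuous_finsetSum _ fun i _ =>
      (hHc i).comp (continuous_apply i)))
  refine ⟨x, hx, hs, fun i hi j => ?_⟩
  rcases eq_or_ne i j with rfl | hij
  · exact le_rfl
  set v : ι → ℝ := Pi.single j 1 - Pi.single i 1 with hv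
  have hd : HasDerivAt (fun t : ℝ => ∑ l, ∫ s in (0 : ℝ)..(x l + t * v l), h l s)
      (∑ l, h l (x l) * v l) 0 := by
    refine HasDerivAt.fun_sum fun l _ => ?_
    have h1 : HasDerivAt (fun t : ℝ => x l + t * v l) (v l) 0 := by
      simpa using ((hasDerivAt_id (0 : ℝ)).mul_const (v l)).const_add (x l)
    have h2 := hH l (x l + 0 * v l)
    have h3 := h2.comp (0 : ℝ) h1
    simpa [Function.comp_def] using h3
  have hsum : ∑ l, h l (x l) * v l = h j (x j) - h i (x i) := by
    simp [hv, mul_sub, sum_sub_distrib, Pi.single_apply]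
  have hnn : 0 ≤ ∑ l, h l (x l) * v l := by
    have ht := (hasDerivAt_iff_tendsto_slope.1 hd).mono_left
      (nhdsWithin_mono (0 : ℝ) (fun t (ht : 0 < t) => ht.ne') : nhdsWithin (0 : ℝ) (Set.Ioi 0) ≤ _)
    refine ge_of_tendsto ht ?_
    filter_upwards [Ioc_mem_nhdsGT hi] with t ht
    have hmem : (fun l => x l + t * v l) ∈ K := by
      refine ⟨fun l => ?_, ?_⟩
      · simp only [hv, Pi.sub_apply, Pi.single_apply]
        have := hx l
        have := ht.1
        have := ht.2
        split_ifs <;> subst_vars <;> first | exact absurd rfl hij | linarith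
      · simp [sum_add_distrib, ← mul_sum, hv, hs]
    have := hmin hmem
    simp only [Set.mem_ofPred_eq] at this
    rw [slope_def_field]
    simp only [zero_mul, add_zero, sub_zero]
    exact div_nonneg (sub_nonneg.2 this) ht.1.le
  linarith

/-- Wardrop equilibria of a given mass are unique for strictly increasing costs. -/
theorem wardrop_unique {ι : Type*} [Fintype ι] {h : ι → ℝ → ℝ} (hm : ∀ i, StrictMono (h i))
    {x y : ι → ℝ} (hx : ∀ i, 0 ≤ x i) (hy : ∀ i, 0 ≤ y i) (hsum : ∑ i, x i = ∑ i, y i)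
    (hxe : ∀ i, 0 < x i → ∀ j, h i (x i) ≤ h j (x j))
    (hye : ∀ i, 0 < y i → ∀ j, h i (y i) ≤ h j (y j)) : x = y := by
  by_contra hne
  have h1 : ∃ i, y i < x i := by
    by_contra! hle
    exact hne (funext fun i => (sum_eq_sum_iff_of_le fun i _ => hle i).1 hsum i (mem_univ i))
  have h2 : ∃ i, x i < y i := by
    by_contra! hle
    exact hne (funext fun i => ((sum_eq_sum_iff_of_le fun i _ => hle i).1 hsum.symm i
      (mem_univ i)).symm)
  obtain ⟨i, hi⟩ := h1
  obtain ⟨j, hj⟩ := h2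
  linarith [hxe i ((hy i).trans_lt hi) j, hye j ((hx j).trans_lt hj) i, hm i hi, hm j hj]

/-- Two masses `a`, `b` share the servers: `a` sits on servers of minimal `p`-cost and `b` on
servers of minimal `c`-cost, costs being evaluated at the total load. -/
def IsSplitEq {ι : Type*} (p c : ι → ℝ → ℝ) (a b : ι → ℝ) : Prop :=
  (∀ i, 0 ≤ a i) ∧ (∀ i, 0 ≤ b i) ∧
  (∀ i j, a i * (p i (a i + b i) - p j (a j + b j)) ≤ 0) ∧
  (∀ i j, b i * (c i (a i + b i) - c j (a j + b j)) ≤ 0)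

/-- A split equilibrium in which the two minimal cost levels differ by `θ`. -/
def IsOffsetEq {ι : Type*} (p c : ι → ℝ → ℝ) (θ : ℝ) (a b : ι → ℝ) : Prop :=
  IsSplitEq p c a b ∧
  (∀ i j, a i * (p i (a i + b i) - (c j (a j + b j) - θ)) ≤ 0) ∧
  (∀ i j, b i * (c i (a i + b i) - θ - p j (a j + b j)) ≤ 0)

theorem exists_isOffsetEq {ι : Type*} [Fintype ι] [Nonempty ι] {p c : ι → ℝ → ℝ}
    (hp : ∀ i, Continuous (p i)) (hc : ∀ i, Continuous (c i)) {N : ℝ} (hN : 0 ≤ N) (θ : ℝ) :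
    ∃ a b, IsOffsetEq p c θ a b ∧ ∑ i, (a i + b i) = N := by
  classical
  obtain ⟨x, hx, hs, he⟩ := exists_wardrop (fun i t => min (p i t) (c i t - θ))
    (fun i => (hp i).min ((hc i).sub continuous_const)) hN
  have key : ∀ i j, 0 < x i → min (p i (x i)) (c i (x i) - θ) ≤ p j (x j) ∧
      min (p i (x i)) (c i (x i) - θ) ≤ c j (x j) - θ := fun i j hi => le_min_iff.1 (he i hi j)
  refine ⟨fun i => if p i (x i) ≤ c i (x i) - θ then x i else 0,
    fun i => if p i (x i) ≤ c i (x i) - θ then 0 else x i, ?_, ?_⟩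
  · have hadd : ∀ i, (if p i (x i) ≤ c i (x i) - θ then x i else 0) +
        (if p i (x i) ≤ c i (x i) - θ then 0 else x i) = x i := fun i => by split_ifs <;> simp
    simp only [IsOffsetEq, IsSplitEq, hadd]
    refine ⟨⟨fun i => ?_, fun i => ?_, fun i j => ?_, fun i j => ?_⟩, fun i j => ?_, fun i j => ?_⟩
    · split_ifs <;> simp [hx]
    · split_ifs <;> simp [hx]
    all_goals
      split_ifs with hle
      all_goals
        first
        | simp
        | rcases (hx i).eq_or_lt with h0 | h0
          · simp [← h0]
          · have hk := key i j h0
            first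
            | rw [min_eq_left hle] at hk
            | rw [min_eq_right (not_le.1 hle).le] at hk
            exact mul_nonpos_of_nonneg_of_nonpos h0.le (by linarith [hk.1, hk.2])
  · rw [← hs]
    exact sum_congr rfl fun i _ => by beta_reduce; split_ifs <;> simp

theorem IsOffsetEq.wardrop {ι : Type*} {p c : ι → ℝ → ℝ} {θ : ℝ} {a b : ι → ℝ}
    (h : IsOffsetEq p c θ a b) (i : ι) (hi : 0 < a i + b i) (j : ι) :
    min (p i (a i + b i)) (c i (a i + b i) - θ) ≤
      min (p j (a j + b j)) (c j (a j + b j) - θ) := by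
  obtain ⟨⟨ha, hb, h1, h2⟩, h3, h4⟩ := h
  rcases (ha i).eq_or_lt with h0 | h0
  · have h0' : 0 < b i := by linarith
    have e1 := nonpos_of_mul_nonpos_right (h2 i j) h0'
    have e2 := nonpos_of_mul_nonpos_right (h4 i j) h0'
    exact (min_le_right _ _).trans (le_min (by linarith) (by linarith))
  · have e1 := nonpos_of_mul_nonpos_right (h1 i j) h0
    have e2 := nonpos_of_mul_nonpos_right (h3 i j) h0
    exact (min_le_left _ _).trans (le_min (by linarith) (by linarith))

theorem isClosed_setOf_isSplitEq {ι X : Type*} [TopologicalSpace X]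
    {p c : ι → X → ℝ → ℝ} (hp : ∀ i, Continuous (Function.uncurry (p i)))
    (hc : ∀ i, Continuous (Function.uncurry (c i))) :
    IsClosed {q : X × (ι → ℝ) × (ι → ℝ) |
      IsSplitEq (fun i => p i q.1) (fun i => c i q.1) q.2.1 q.2.2} := by
  have hp' : ∀ i, Continuous fun q : X × (ι → ℝ) × (ι → ℝ) => p i q.1 (q.2.1 i + q.2.2 i) :=
    fun i => (hp i).comp (by fun_prop : Continuous fun q : X × (ι → ℝ) × (ι → ℝ) =>
      (q.1, q.2.1 i + q.2.2 i))
  have hc' : ∀ i, Continuous fun q : X × (ι → ℝ) × (ι → ℝ) => c i q.1 (q.2.1 i + q.2.2 i) :=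
    fun i => (hc i).comp (by fun_prop : Continuous fun q : X × (ι → ℝ) × (ι → ℝ) =>
      (q.1, q.2.1 i + q.2.2 i))
  simp only [IsSplitEq, Set.ofPred_and, Set.ofPred_forall]
  refine IsClosed.inter ?_ (IsClosed.inter ?_ (IsClosed.inter ?_ ?_))
  · exact isClosed_iInter fun i => isClosed_le (by fun_prop) (by fun_prop)
  · exact isClosed_iInter fun i => isClosed_le (by fun_prop) (by fun_prop)
  · exact isClosed_iInter fun i => isClosed_iInter fun j =>
      isClosed_le (by fun_prop) continuous_const
  · exact isClosed_iInter fun i => isClosed_iInter fun j =>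
      isClosed_le (by fun_prop) continuous_const

theorem isClosed_setOf_isOffsetEq {ι : Type*} {p c : ι → ℝ → ℝ} (hp : ∀ i, Continuous (p i))
    (hc : ∀ i, Continuous (c i)) :
    IsClosed {q : ℝ × (ι → ℝ) × (ι → ℝ) | IsOffsetEq p c q.1 q.2.1 q.2.2} := by
  simp only [IsOffsetEq, Set.ofPred_and, Set.ofPred_forall]
  refine IsClosed.inter ?_ (IsClosed.inter ?_ ?_)
  · exact isClosed_setOf_isSplitEq (p := fun i _ => p i) (c := fun i _ => c i)
      (fun i => (hp i).comp continuous_snd) (fun i => (hc i).comp continuous_snd)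
  · exact isClosed_iInter fun i => isClosed_iInter fun j =>
      isClosed_le (by fun_prop) continuous_const
  · exact isClosed_iInter fun i => isClosed_iInter fun j =>
      isClosed_le (by fun_prop) continuous_const

/-- Parameters in `[l, u]` paired by a closed set with some bounded loads form a closed set. -/
theorem isClosed_setOf_exists_bounded {ι : Type*} {F : Set (ℝ × (ι → ℝ) × (ι → ℝ))}
    (hF : IsClosed F) (l u N : ℝ)
    (hb : ∀ q ∈ F, (∀ i, q.2.1 i ∈ Set.Icc 0 N) ∧ ∀ i, q.2.2 i ∈ Set.Icc 0 N) :
    IsClosed {θ | θ ∈ Set.Icc l u ∧ ∃ a b, (θ, a, b) ∈ F} := by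
  have hK : IsCompact ((Set.Icc l u ×ˢ (Set.Icc (0 : ι → ℝ) (fun _ => N) ×ˢ
      Set.Icc (0 : ι → ℝ) (fun _ => N))) ∩ F) :=
    (isCompact_Icc.prod (isCompact_Icc.prod isCompact_Icc)).inter_right hF
  convert (hK.image continuous_fst).isClosed using 1
  ext θ
  constructor
  · rintro ⟨hθ, a, b, hab⟩
    obtain ⟨h1, h2⟩ := hb _ hab
    exact ⟨(θ, a, b), ⟨⟨hθ, ⟨fun i => (h1 i).1, fun i => (h1 i).2⟩,
      ⟨fun i => (h2 i).1, fun i => (h2 i).2⟩⟩, hab⟩, rfl⟩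
  · rintro ⟨⟨θ', a, b⟩, ⟨⟨hθ, -⟩, hab⟩, rfl⟩
    exact ⟨hθ, a, b, hab⟩

theorem IsSplitEq.add_le {ι : Type*} [Fintype ι] {p c : ι → ℝ → ℝ} {a b : ι → ℝ} {N : ℝ}
    (h : IsSplitEq p c a b) (hs : ∑ i, (a i + b i) = N) (i : ι) : a i + b i ≤ N := by
  rw [← hs]
  exact single_le_sum (f := fun i => a i + b i)
    (fun j _ => add_nonneg (h.1 j) (h.2.1 j)) (mem_univ i)

theorem IsSplitEq.mem_Icc {ι : Type*} [Fintype ι] {p c : ι → ℝ → ℝ} {a b : ι → ℝ} {N : ℝ}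
    (h : IsSplitEq p c a b) (hs : ∑ i, (a i + b i) = N) :
    (∀ i, a i ∈ Set.Icc 0 N) ∧ ∀ i, b i ∈ Set.Icc 0 N :=
  ⟨fun i => ⟨h.1 i, by linarith [h.add_le hs i, h.2.1 i]⟩,
    fun i => ⟨h.2.1 i, by linarith [h.add_le hs i, h.1 i]⟩⟩

theorem exists_isSplitEq_of_strictMono {ι : Type*} [Fintype ι] [Nonempty ι] {p c : ι → ℝ → ℝ}
    (hp : ∀ i, Continuous (p i)) (hc : ∀ i, Continuous (c i))
    (hpm : ∀ i, StrictMono (p i)) (hcm : ∀ i, StrictMono (c i))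
    {S N : ℝ} (hS : 0 ≤ S) (hSN : S ≤ N) :
    ∃ a b, IsSplitEq p c a b ∧ ∑ i, a i = S ∧ ∑ i, (a i + b i) = N := by
  have hN : 0 ≤ N := hS.trans hSN
  obtain ⟨B, hB0, hB⟩ : ∃ B : ℝ, 0 ≤ B ∧ ∀ i, ∀ t ∈ Set.Icc 0 N, |c i t - p i t| < B := by
    have : ∀ i, ∃ B : ℝ, ∀ t ∈ Set.Icc 0 N, |c i t - p i t| ≤ B := fun i => by
      obtain ⟨B, hB⟩ := (isCompact_Icc (a := (0 : ℝ)) (b := N)).exists_bound_of_continuousOn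
        ((hc i).sub (hp i)).continuousOn
      exact ⟨B, hB⟩
    choose B hB using this
    have hB0 : ∀ i, 0 ≤ B i := fun i => (abs_nonneg _).trans (hB i 0 ⟨le_rfl, hN⟩)
    refine ⟨∑ i, B i + 1, add_nonneg (sum_nonneg fun i _ => hB0 i) zero_le_one,
      fun i t ht => ?_⟩
    linarith [hB i t ht, single_le_sum (fun j _ => hB0 j) (mem_univ i)]
  have hclosed := isClosed_setOf_isOffsetEq hp hc
  have hsumc : IsClosed {q : ℝ × (ι → ℝ) × (ι → ℝ) | ∑ i, (q.2.1 i + q.2.2 i) = N} :=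
    isClosed_eq (by fun_prop) continuous_const
  have hA := isClosed_setOf_exists_bounded ((hclosed.inter hsumc).inter
    (isClosed_le (f := fun _ => S) (g := fun q : ℝ × (ι → ℝ) × (ι → ℝ) => ∑ i, q.2.1 i)
      continuous_const (by fun_prop))) (-B) B N (fun q hq => hq.1.1.1.mem_Icc hq.1.2)
  have hA' := isClosed_setOf_exists_bounded ((hclosed.inter hsumc).inter
    (isClosed_le (f := fun q : ℝ × (ι → ℝ) × (ι → ℝ) => ∑ i, q.2.1 i) (g := fun _ => S)
      (by fun_prop) continuous_const)) (-B) B N (fun q hq => hq.1.1.1.mem_Icc hq.1.2)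
  obtain ⟨θ, -, ⟨-, a, b, ⟨hab, hs⟩, hSa⟩, -, a', b', ⟨hab', hs'⟩, hSa'⟩ :=
    isPreconnected_closed_iff.1 (isPreconnected_Icc (a := -B) (b := B)) _ _ hA hA'
      (by
        intro θ hθ
        obtain ⟨a, b, hab, hs⟩ := exists_isOffsetEq hp hc hN θ
        rcases le_total S (∑ i, a i) with h | h
        · exact Or.inl ⟨hθ, a, b, ⟨hab, hs⟩, h⟩
        · exact Or.inr ⟨hθ, a, b, ⟨hab, hs⟩, h⟩)
      (by
        have hθ : -B ∈ Set.Icc (-B) B := ⟨le_rfl, by linarith⟩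
        obtain ⟨a, b, hab, hs⟩ := exists_isOffsetEq hp hc hN (-B)
        refine ⟨-B, hθ, hθ, a, b, ⟨hab, hs⟩, ?_⟩
        have hb0 : ∀ i, b i = 0 := fun i => by
          by_contra hne
          have h0 : 0 < b i := lt_of_le_of_ne (hab.1.2.1 i) (Ne.symm hne)
          have e := nonpos_of_mul_nonpos_right (hab.2.2 i i) h0
          have hle := hab.1.add_le hs i
          have := (abs_lt.1 (hB i (a i + b i) ⟨by linarith [hab.1.1 i], hle⟩)).1
          linarith
        simp only [hb0, add_zero] at hs
        exact hSN.trans hs.ge)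
      (by
        have hθ : B ∈ Set.Icc (-B) B := ⟨by linarith, le_rfl⟩
        obtain ⟨a, b, hab, hs⟩ := exists_isOffsetEq hp hc hN B
        refine ⟨B, hθ, hθ, a, b, ⟨hab, hs⟩, ?_⟩
        have ha0 : ∀ i, a i = 0 := fun i => by
          by_contra hne
          have h0 : 0 < a i := lt_of_le_of_ne (hab.1.1 i) (Ne.symm hne)
          have e := nonpos_of_mul_nonpos_right (hab.2.1 i i) h0
          have hle := hab.1.add_le hs i
          have := (abs_lt.1 (hB i (a i + b i) ⟨by linarith [hab.1.2.1 i], hle⟩)).2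
          linarith
        simpa [ha0] using hS)
  simp only [Set.mem_ofPred_eq] at hs hSa hs' hSa'
  have hx : (fun i => a i + b i) = fun i => a' i + b' i :=
    wardrop_unique (h := fun i t => min (p i t) (c i t - θ))
      (fun i s t hst => lt_min ((min_le_left _ _).trans_lt (hpm i hst))
        ((min_le_right _ _).trans_lt (sub_lt_sub_right (hcm i hst) θ)))
      (fun i => add_nonneg (hab.1.1 i) (hab.1.2.1 i))
      (fun i => add_nonneg (hab'.1.1 i) (hab'.1.2.1 i)) (hs.trans hs'.symm)
      hab.wardrop hab'.wardrop
  obtain ⟨u, v, hu, hv, huv, hcomb⟩ : ∃ u v : ℝ, 0 ≤ u ∧ 0 ≤ v ∧ u + v = 1 ∧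
      u * ∑ i, a' i + v * ∑ i, a i = S := by
    have : S ∈ segment ℝ (∑ i, a' i) (∑ i, a i) := by
      rw [segment_eq_Icc (hSa'.trans hSa)]
      exact ⟨hSa', hSa⟩
    obtain ⟨u, v, hu, hv, huv, h⟩ := this
    exact ⟨u, v, hu, hv, huv, h⟩
  have hxi : ∀ i, a' i + b' i = a i + b i := fun i => (congrFun hx i).symm
  have hadd : ∀ i, (u * a' i + v * a i) + (u * b' i + v * b i) = a i + b i := fun i => by
    linear_combination u * hxi i + (a i + b i) * huv
  obtain ⟨⟨ha, hb, h1, h2⟩, -, -⟩ := hab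
  obtain ⟨⟨ha', hb', h1', h2'⟩, -, -⟩ := hab'
  simp only [hxi] at h1' h2'
  refine ⟨fun i => u * a' i + v * a i, fun i => u * b' i + v * b i, ⟨fun i => ?_, fun i => ?_,
    fun i j => ?_, fun i j => ?_⟩, ?_, ?_⟩
  · exact add_nonneg (mul_nonneg hu (ha' i)) (mul_nonneg hv (ha i))
  · exact add_nonneg (mul_nonneg hu (hb' i)) (mul_nonneg hv (hb i))
  · simp only [hadd]
    linarith [mul_nonpos_of_nonneg_of_nonpos hu (h1' i j),
      mul_nonpos_of_nonneg_of_nonpos hv (h1 i j)]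
  · simp only [hadd]
    linarith [mul_nonpos_of_nonneg_of_nonpos hu (h2' i j),
      mul_nonpos_of_nonneg_of_nonpos hv (h2 i j)]
  · rw [sum_add_distrib, ← mul_sum, ← mul_sum, hcomb]
  · simp only [hadd, hs]

/-- Split equilibria of prescribed masses exist for continuous nondecreasing costs. -/
theorem exists_isSplitEq {ι : Type*} [Fintype ι] [Nonempty ι] {p c : ι → ℝ → ℝ}
    (hp : ∀ i, Continuous (p i)) (hc : ∀ i, Continuous (c i))
    (hpm : ∀ i, Monotone (p i)) (hcm : ∀ i, Monotone (c i))
    {S N : ℝ} (hS : 0 ≤ S) (hSN : S ≤ N) :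
    ∃ a b, IsSplitEq p c a b ∧ ∑ i, a i = S ∧ ∑ i, (a i + b i) = N := by
  have hF : IsClosed {q : ℝ × (ι → ℝ) × (ι → ℝ) |
      IsSplitEq (fun i t => p i t + q.1 * t) (fun i t => c i t + q.1 * t) q.2.1 q.2.2 ∧
        ∑ i, q.2.1 i = S ∧ ∑ i, (q.2.1 i + q.2.2 i) = N} := by
    refine (isClosed_setOf_isSplitEq (p := fun i ε t => p i t + ε * t)
      (c := fun i ε t => c i t + ε * t) (fun i => ?_) (fun i => ?_)).inter
      ((isClosed_eq (by fun_prop) continuous_const).inter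
        (isClosed_eq (by fun_prop) continuous_const))
    · exact ((hp i).comp continuous_snd).add (continuous_fst.mul continuous_snd)
    · exact ((hc i).comp continuous_snd).add (continuous_fst.mul continuous_snd)
  have hcl := isClosed_setOf_exists_bounded hF 0 1 N (fun q hq => hq.1.mem_Icc hq.2.2)
  have h0 : (0 : ℝ) ∈ closure (Set.Ioc (0 : ℝ) 1) := by
    rw [closure_Ioc zero_ne_one]
    exact ⟨le_rfl, zero_le_one⟩
  obtain ⟨-, a, b, h, hs, hs'⟩ := closure_minimal (fun ε hε => by
    exact ⟨⟨hε.1.le, hε.2⟩, exists_isSplitEq_of_strictMono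
      (p := fun i t => p i t + ε * t) (c := fun i t => c i t + ε * t)
      (fun i => (hp i).add (by fun_prop)) (fun i => (hc i).add (by fun_prop))
      (fun i => (hpm i).add_strictMono fun _ _ h => mul_lt_mul_of_pos_left h hε.1)
      (fun i => (hcm i).add_strictMono fun _ _ h => mul_lt_mul_of_pos_left h hε.1)
      hS hSN⟩) hcl h0
  exact ⟨a, b, by simpa using h, hs, hs'⟩

/-- Marginal-cost inequality for `t ↦ t * f t` with `f` convex and nondecreasing. -/
theorem ConvexOn.mul_self_tangent {f : ℝ → ℝ} (hf : ConvexOn ℝ (Set.Ici 0) f)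
    (hm : MonotoneOn f (Set.Ici 0)) (hd : DifferentiableOn ℝ f (Set.Ici 0)) {s t : ℝ}
    (hs : 0 ≤ s) (ht : 0 ≤ t) :
    (f s + s * derivWithin f (Set.Ici 0) s) * (t - s) ≤ t * f t - s * f s := by
  have htan : derivWithin f (Set.Ici 0) s * (t - s) ≤ f t - f s := by
    rcases lt_trichotomy s t with h | rfl | h
    · have := hf.derivWithin_le_slope hs ht h (hd s hs)
      rwa [slope_def_field, le_div_iff₀ (sub_pos.2 h)] at this
    · simp
    · have := hf.slope_le_derivWithin ht hs h (hd s hs)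
      rw [slope_def_field, div_le_iff₀ (sub_pos.2 h)] at this
      linarith
  have hnn : 0 ≤ derivWithin f (Set.Ici 0) s := hm.derivWithin_nonneg
  nlinarith [mul_le_mul_of_nonneg_left htan ht, mul_nonneg hnn (sq_nonneg (t - s))]

/-- If `b` sits on coordinates of minimal value of `g`, it minimizes `∑ i, g i * b i` among
nonnegative vectors of its mass. -/
theorem sum_mul_sub_nonneg_of_support_min {ι : Type*} [Fintype ι] [Nonempty ι] {g b y : ι → ℝ}
    (hy : ∀ i, 0 ≤ y i) (hs : ∑ i, y i = ∑ i, b i) (h : ∀ i j, b i * (g i - g j) ≤ 0) :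
    0 ≤ ∑ i, g i * (y i - b i) := by
  obtain ⟨k, hk⟩ := Finite.exists_min g
  have hz : ∑ i, g k * (y i - b i) = 0 := by
    rw [← mul_sum, sum_sub_distrib, hs, sub_self, mul_zero]
  rw [← hz]
  refine sum_le_sum fun i _ => ?_
  nlinarith [mul_nonneg (hy i) (sub_nonneg.2 (hk i)), h i k]

theorem cost_eq (n : ℕ) [NeZero n] (τ : Fin n → ℝ → ℝ) (α : ℝ) (x : Fin n → ℝ) :
    cost n τ α x = (∑ i, x i * tauA n τ α i (x i)) / n := by
  simp [cost, tauA, mul_add, sum_add_distrib, add_div, mul_comm]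

/-- existence of a team equilibrium. -/
theorem team_equilibrium_exists (n m : ℕ) [NeZero n] (hn : 2 ≤ n) (hm : 1 ≤ m)
    (τ : Fin n → ℝ → ℝ)
    (hconv : ∀ i, ConvexOn ℝ (Set.Ici 0) (τ i))
    (hmono : ∀ i, MonotoneOn (τ i) (Set.Ici 0))
    (hsmooth : ∀ i, ContDiffOn ℝ 1 (τ i) (Set.Ici 0))
    (hzero : ∀ i j, τ i 0 = τ j 0)
    (α : ℝ) (hα : 0 ≤ α)
    (r : Fin m → ℝ) (hr : ∀ k, 0 ≤ r k) (hrsum : ∑ k, r k ≤ (n : ℝ)) :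
    ∃ (xs : Fin n → ℝ) (xk : Fin m → Fin n → ℝ), IsTeamEq n m τ α r xs xk := by
  have hd : ∀ i, DifferentiableOn ℝ (τ i) (Set.Ici 0) := fun i =>
    (hsmooth i).differentiableOn one_ne_zero
  set d : Fin n → ℝ → ℝ := fun i => derivWithin (τ i) (Set.Ici 0) with hd_def
  have hdm : ∀ i, MonotoneOn (d i) (Set.Ici 0) := fun i => (hconv i).monotoneOn_derivWithin (hd i)
  have hdn : ∀ i t, 0 ≤ d i t := fun i t => (hmono i).derivWithin_nonneg
  have hdc : ∀ i, ContinuousOn (d i) (Set.Ici 0) := fun i =>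
    (hsmooth i).continuousOn_derivWithin (uniqueDiffOn_Ici 0) le_rfl
  have hpos : ∀ t : ℝ, max t 0 ∈ Set.Ici (0 : ℝ) := fun t => le_max_right t 0
  have hmax : Continuous fun t : ℝ => max t 0 := by fun_prop
  set p : Fin n → ℝ → ℝ := fun i t => tauA n τ α i (max t 0) with hp_def
  set c : Fin n → ℝ → ℝ := fun i t => p i t + max t 0 * d i (max t 0) with hc_def
  have hp : ∀ i, Continuous (p i) := fun i =>
    ((hd i).continuousOn.comp_continuous hmax hpos).add continuous_const
  have hc : ∀ i, Continuous (c i) := fun i =>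
    (hp i).add (hmax.mul ((hdc i).comp_continuous hmax hpos))
  have hpm : ∀ i, Monotone (p i) := fun i s t hst =>
    add_le_add_left (hmono i (hpos s) (hpos t) (max_le_max_right 0 hst)) _
  have hcm : ∀ i, Monotone (c i) := fun i s t hst =>
    add_le_add (hpm i hst) (mul_le_mul (max_le_max_right 0 hst)
      (hdm i (hpos s) (hpos t) (max_le_max_right 0 hst)) (hdn i _) (hpos t))
  have hR : 0 ≤ ∑ k, r k := sum_nonneg fun k _ => hr k
  obtain ⟨a, b, ⟨ha, hb, hab, hba⟩, hsa, hsab⟩ :=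
    exists_isSplitEq hp hc hpm hcm (S := n - ∑ k, r k) (N := n) (by linarith) (by linarith)
  have hsb : ∑ i, b i = ∑ k, r k := by
    rw [sum_add_distrib] at hsab
    linarith
  have hx : ∀ i, 0 ≤ a i + b i := fun i => add_nonneg (ha i) (hb i)
  have hpx : ∀ i, p i (a i + b i) = tauA n τ α i (a i + b i) := fun i => by
    simp only [hp_def, max_eq_left (hx i)]
  have hcx : ∀ i, c i (a i + b i) =
      tauA n τ α i (a i + b i) + (a i + b i) * d i (a i + b i) := fun i => by
    simp only [hc_def, hp_def, max_eq_left (hx i)]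
  set xk : Fin m → Fin n → ℝ := fun k i => r k / (∑ l, r l) * b i with hxk
  have hxk0 : ∀ k i, 0 ≤ xk k i := fun k i => mul_nonneg (div_nonneg (hr k) hR) (hb i)
  have hxks : ∑ k, xk k = b := by
    ext i
    simp only [hxk, Finset.sum_apply, ← sum_mul, ← sum_div]
    rcases eq_or_ne (∑ l, r l) 0 with h0 | h0
    · rw [h0] at hsb
      simp [(sum_eq_zero_iff_of_nonneg fun i _ => hb i).1 hsb i (mem_univ i)]
    · rw [div_self h0, one_mul]
  have hxkm : ∀ k, ∑ i, xk k i = r k := fun k => by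
    simp only [hxk, ← mul_sum, hsb]
    rcases eq_or_ne (∑ l, r l) 0 with h0 | h0
    · simp [h0, (sum_eq_zero_iff_of_nonneg fun k _ => hr k).1 h0 k (mem_univ k)]
    · exact div_mul_cancel₀ _ h0
  have hopt : ∀ y : Fin n → ℝ, (∀ i, 0 ≤ y i) → ∑ i, y i = ∑ k, r k →
      cost n τ α (a + b) ≤ cost n τ α (a + y) := fun y hy hys => by
    rw [cost_eq, cost_eq]
    refine div_le_div_of_nonneg_right ?_ (Nat.cast_nonneg n)
    rw [← sub_nonneg, ← sum_sub_distrib]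
    refine (sum_mul_sub_nonneg_of_support_min hy (hys.trans hsb.symm) hba).trans
      (sum_le_sum fun i _ => ?_)
    have := (hconv i).mul_self_tangent (hmono i) (hd i) (hx i) (add_nonneg (ha i) (hy i))
    simp only [hcx, tauA, Pi.add_apply]
    linarith
  refine ⟨a, xk, ⟨ha, hsa⟩, fun k => ⟨hxk0 k, hxkm k⟩, fun k y hy => ?_, fun i hi j => ?_⟩
  · rw [hxks, add_assoc]
    refine hopt _ (fun i => ?_) ?_
    · rw [Pi.add_apply, Finset.sum_apply]
      exact add_nonneg (hy.1 i) (sum_nonneg fun l _ => hxk0 l i)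
    · simp only [Pi.add_apply, Finset.sum_apply, sum_add_distrib, hy.2]
      rw [sum_comm]
      simp only [hxkm]
      exact add_sum_erase _ _ (mem_univ k)
  · have := nonpos_of_mul_nonpos_right (hab i j) hi
    rw [hpx, hpx] at this
    rw [hxks]
    exact sub_nonpos.1 this
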